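/- Let X be a simplicial complex on [n] and 𝐜 = 𝐚 − 𝐛 with 𝐚 ∈ ℕ^{n+1} of support a ⊆ [n] and 𝐛 ∈ {0,1}^{n+1} the characteristic vector of b ⊆ [n], where a ∩ b = ∅. For every f ∈ N_{a−b} one has f ∪ b ∉ X (so x^{f∪b} ∈ I_X) and π(x^{𝐟+𝐚}) ≠ 0 in A_X (𝐟 the characteristic vector of f), and the assignment φ ↦ λ_φ — where λ_φ(f) is the unique scalar with φ(x^{f∪b}) = λ_φ(f)·π(x^{𝐟+𝐚}) — is a ℂ-linear isomorphism from Hom(I_X, A_X)_𝐜 onto the space {λ : N_{a−b} → ℂ : λ(f) = 0 for all f ∈ Ñ_{a−b}, and λ(f) = λ(g) whenever f, g ∈ N_{a−b} with f ∪ g ∈ X}. -/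

import Mathlib

open MvPolynomial

/-- A simplicial complex on `[n] = {0,…,n}`. -/
def IsSimplicialComplex {n : ℕ} (S : Set (Finset (Fin (n+1)))) : Prop :=
  ∅ ∈ S ∧ ∀ f ∈ S, ∀ g ⊆ f, g ∈ S

/-- The squarefree monomial `x^p = ∏_{i ∈ p} x_i`. -/
noncomputable def xmon {n : ℕ} (p : Finset (Fin (n+1))) : MvPolynomial (Fin (n+1)) ℂ :=
  ∏ i ∈ p, X i

/-- The monomial `x^e` for an exponent vector `e ∈ ℕ^{n+1}`. -/
noncomputable def emon {n : ℕ} (e : Fin (n+1) → ℕ) : MvPolynomial (Fin (n+1)) ℂ :=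
  monomial (Finsupp.equivFunOnFinite.symm e) 1

/-- The Stanley–Reisner ideal `I_X = (x^p : p ∉ X)`. -/
noncomputable def SRideal {n : ℕ} (S : Set (Finset (Fin (n+1)))) : Ideal (MvPolynomial (Fin (n+1)) ℂ) :=
  Ideal.span {q | ∃ p : Finset (Fin (n+1)), p ∉ S ∧ q = xmon p}

lemma xmon_mem_SRideal {n : ℕ} (S : Set (Finset (Fin (n+1))))
    {p : Finset (Fin (n+1))} (hp : p ∉ S) : xmon p ∈ SRideal S :=
  Ideal.subset_span ⟨p, hp, rfl⟩

/-- The characteristic vector of `p ⊆ [n]`. -/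
def charVec {n : ℕ} (p : Finset (Fin (n+1))) : Fin (n+1) → ℕ :=
  fun i => if i ∈ p then 1 else 0

/-- The degree `𝐜 = 𝐚 − 𝐛 ∈ ℤ^{n+1}` where `𝐛` is the characteristic vector of `b`. -/
def degC {n : ℕ} (A : Fin (n+1) → ℕ) (b : Finset (Fin (n+1))) : Fin (n+1) → ℤ :=
  fun i => (A i : ℤ) - (charVec b i : ℤ)

/-- The shifted exponent `𝐩 + 𝐜` (as a vector of naturals, when nonnegative). -/
def shiftExp {n : ℕ} (p : Finset (Fin (n+1))) (c : Fin (n+1) → ℤ) : Fin (n+1) → ℕ :=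
  fun i => ((charVec p i : ℤ) + c i).toNat

/-- A `P`-module homomorphism `φ : I_X → A_X` is homogeneous of degree `𝐜`:
for every non-face `p`, `φ(x^p)` is a scalar multiple of `π(x^{𝐩+𝐜})` when
`𝐩 + 𝐜 ∈ ℕ^{n+1}`, and `φ(x^p) = 0` otherwise. -/
def IsHomOfDeg {n : ℕ} (S : Set (Finset (Fin (n+1))))
    (φ : SRideal S →ₗ[MvPolynomial (Fin (n+1)) ℂ] (MvPolynomial (Fin (n+1)) ℂ ⧸ SRideal S))
    (c : Fin (n+1) → ℤ) : Prop :=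
  ∀ (p : Finset (Fin (n+1))) (hp : p ∉ S),
    ((∀ i, 0 ≤ (charVec p i : ℤ) + c i) →
      ∃ μ : ℂ, φ ⟨xmon p, xmon_mem_SRideal S hp⟩ =
        Ideal.Quotient.mk (SRideal S) (C μ * emon (shiftExp p c))) ∧
    (¬ (∀ i, 0 ≤ (charVec p i : ℤ) + c i) →
      φ ⟨xmon p, xmon_mem_SRideal S hp⟩ = 0)

/-- The support of a vector `𝐚 ∈ ℕ^{n+1}`. -/
def suppV {n : ℕ} (A : Fin (n+1) → ℕ) : Finset (Fin (n+1)) :=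
  Finset.univ.filter (fun i => A i ≠ 0)

/-- `N_{a−b} = {f ∈ X : a ⊆ f, f ∩ b = ∅, f ∪ b ∉ X}`. -/
def Nab {n : ℕ} (S : Set (Finset (Fin (n+1)))) (a b : Finset (Fin (n+1))) :
    Set (Finset (Fin (n+1))) :=
  {f | f ∈ S ∧ a ⊆ f ∧ f ∩ b = ∅ ∧ f ∪ b ∉ S}

/-- `Ñ_{a−b} = {f ∈ N_{a−b} : f ∪ b′ ∉ X for some proper subset b′ ⊊ b}`. -/
def Ntilde {n : ℕ} (S : Set (Finset (Fin (n+1)))) (a b : Finset (Fin (n+1))) :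
    Set (Finset (Fin (n+1))) :=
  {f | f ∈ Nab S a b ∧ ∃ b' ⊂ b, f ∪ b' ∉ S}

/-- The exponent vector `e` regarded as a finitely supported function has support `suppV e`. -/
lemma support_equivFunOnFinite_symm {n : ℕ} (e : Fin (n+1) → ℕ) :
    (Finsupp.equivFunOnFinite.symm e).support = suppV e := by
  ext i; simp [suppV]

lemma emon_add {n : ℕ} (e e' : Fin (n+1) → ℕ) : emon (e + e') = emon e * emon e' := by
  simp only [emon, monomial_mul, mul_one]
  rw [show Finsupp.equivFunOnFinite.symm (e + e') = Finsupp.equivFunOnFinite.symm e +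
    Finsupp.equivFunOnFinite.symm e' from Finsupp.ext fun _ => rfl]

lemma xmon_eq_emon {n : ℕ} (p : Finset (Fin (n+1))) : xmon p = emon (charVec p) := by
  rw [emon, monomial_eq, Finsupp.prod_fintype _ _ (by simp)]
  simp [xmon, charVec, Finset.prod_ite_mem, pow_ite]

lemma suppV_charVec {n : ℕ} (p : Finset (Fin (n+1))) : suppV (charVec p) = p := by
  ext i; simp [suppV, charVec]

lemma suppV_add {n : ℕ} (e e' : Fin (n+1) → ℕ) : suppV (e + e') = suppV e ∪ suppV e' := by
  ext i; simp only [suppV, Pi.add_apply, Finset.mem_filter, Finset.mem_union]; grind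

lemma mem_SRideal_iff {n : ℕ} {S : Set (Finset (Fin (n+1)))} (hS : IsSimplicialComplex S)
    (u : MvPolynomial (Fin (n+1)) ℂ) :
    u ∈ SRideal S ↔ ∀ m ∈ u.support, m.support ∉ S := by
  have h : SRideal S = Ideal.span ((fun m => monomial m (1 : ℂ)) ''
      {m | ∃ p, p ∉ S ∧ m = Finsupp.equivFunOnFinite.symm (charVec p)}) := by
    unfold SRideal
    congr 1
    ext q
    simp only [Set.mem_ofPred_eq, Set.mem_image, xmon_eq_emon, emon]
    grind
  rw [h, mem_ideal_span_monomial_image]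
  refine forall₂_congr fun m _ => ⟨?_, fun hm => ⟨_, ⟨m.support, hm, rfl⟩, fun i => ?_⟩⟩
  · rintro ⟨_, ⟨p, hp, rfl⟩, hle⟩ hm
    refine hp (hS.2 _ hm _ fun i hi => ?_)
    have := hle i
    simp [charVec, hi] at this
    simp; omega
  · by_cases hi : m i = 0 <;> simp [charVec, hi]; omega

lemma mk_C_mul_emon_eq_zero_iff {n : ℕ} {S : Set (Finset (Fin (n+1)))}
    (hS : IsSimplicialComplex S) (μ : ℂ) (e : Fin (n+1) → ℕ) :
    Ideal.Quotient.mk (SRideal S) (C μ * emon e) = 0 ↔ μ = 0 ∨ suppV e ∉ S := by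
  rw [Ideal.Quotient.eq_zero_iff_mem, mem_SRideal_iff hS, emon, C_mul_monomial, mul_one,
    ← support_equivFunOnFinite_symm]
  by_cases h : μ = 0
  · simp [h]
  · simp [h, support_monomial]

lemma mk_C_mul_emon_inj {n : ℕ} {S : Set (Finset (Fin (n+1)))}
    (hS : IsSimplicialComplex S) {e : Fin (n+1) → ℕ} (he : suppV e ∈ S) {μ ν : ℂ}
    (h : Ideal.Quotient.mk (SRideal S) (C μ * emon e) =
      Ideal.Quotient.mk (SRideal S) (C ν * emon e)) : μ = ν := by
  rw [← sub_eq_zero, ← map_sub, ← sub_mul, ← C_sub, mk_C_mul_emon_eq_zero_iff hS] at h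
  grind

/-- Linear maps out of the Stanley–Reisner ideal commute with multiplication of its
squarefree generators by monomials. -/
lemma map_xmon_eq_emon_mul {n : ℕ} {S : Set (Finset (Fin (n+1)))}
    (φ : SRideal S →ₗ[MvPolynomial (Fin (n+1)) ℂ] (MvPolynomial (Fin (n+1)) ℂ ⧸ SRideal S))
    {p q : Finset (Fin (n+1))} (hp : p ∉ S) (hq : q ∉ S) (hpq : p ⊆ q) :
    φ ⟨xmon q, xmon_mem_SRideal S hq⟩ =
      Ideal.Quotient.mk (SRideal S) (emon (charVec (q \ p))) *
        φ ⟨xmon p, xmon_mem_SRideal S hp⟩ := by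
  have : (⟨xmon q, xmon_mem_SRideal S hq⟩ : SRideal S) =
      emon (charVec (q \ p)) • ⟨xmon p, xmon_mem_SRideal S hp⟩ := by
    ext1
    simp only [SetLike.mk_smul_mk, smul_eq_mul, xmon_eq_emon, ← emon_add]
    congr 1
    funext i
    simp only [charVec, Pi.add_apply, Finset.mem_sdiff]
    have := @hpq i
    grind
  exact (congrArg φ this).trans (φ.map_smul _ _)

lemma linearMap_SRideal_ext {n : ℕ} {S : Set (Finset (Fin (n+1)))}
    {φ ψ : SRideal S →ₗ[MvPolynomial (Fin (n+1)) ℂ] (MvPolynomial (Fin (n+1)) ℂ ⧸ SRideal S)}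
    (h : ∀ p (hp : p ∉ S), φ ⟨xmon p, xmon_mem_SRideal S hp⟩ =
      ψ ⟨xmon p, xmon_mem_SRideal S hp⟩) : φ = ψ := by
  rw [Submodule.linearMap_eq_iff_of_eq_span φ ψ (S := {q | ∃ p, p ∉ S ∧ q = xmon p}) rfl]
  rintro ⟨_, p, hp, rfl⟩
  exact h p hp

/-- The `ℂ`-linear map sending `x^𝐦` to `k (supp 𝐦) • x^{𝐦 − 𝐛 + 𝐚}`, with truncated
subtraction. -/
noncomputable def shiftMap {n : ℕ} (A : Fin (n+1) → ℕ) (b : Finset (Fin (n+1)))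
    (k : Finset (Fin (n+1)) → ℂ) :
    MvPolynomial (Fin (n+1)) ℂ →ₗ[ℂ] MvPolynomial (Fin (n+1)) ℂ :=
  (basisMonomials (Fin (n+1)) ℂ).constr ℂ fun m =>
    C (k m.support) * emon fun i => m i - charVec b i + A i

lemma shiftMap_monomial {n : ℕ} (A : Fin (n+1) → ℕ) (b : Finset (Fin (n+1)))
    (k : Finset (Fin (n+1)) → ℂ) (m : Fin (n+1) →₀ ℕ) (r : ℂ) :
    shiftMap A b k (monomial m r) =
      C r * (C (k m.support) * emon fun i => m i - charVec b i + A i) := by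
  have h : monomial m r = r • basisMonomials (Fin (n+1)) ℂ m := by
    simp [smul_monomial]
  rw [h, map_smul, shiftMap, Module.Basis.constr_basis, smul_eq_C_mul]

lemma shiftMap_xmon {n : ℕ} (A : Fin (n+1) → ℕ) (b : Finset (Fin (n+1)))
    (k : Finset (Fin (n+1)) → ℂ) (p : Finset (Fin (n+1))) :
    shiftMap A b k (xmon p) =
      C (k p) * emon fun i => charVec p i - charVec b i + A i := by
  rw [xmon_eq_emon, emon, shiftMap_monomial, support_equivFunOnFinite_symm, suppV_charVec]
  simp

lemma X_eq_emon {n : ℕ} (i : Fin (n+1)) : (X i : MvPolynomial (Fin (n+1)) ℂ) =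
    emon (Pi.single i 1) := by
  rw [emon, X]
  congr 1
  ext j
  simp

/-- A coefficient function on supports for which `shiftMap` is `P`-linear on the
Stanley–Reisner ideal modulo that ideal. -/
structure IsShiftCompatible {n : ℕ} (S : Set (Finset (Fin (n+1)))) (A : Fin (n+1) → ℕ)
    (b : Finset (Fin (n+1))) (k : Finset (Fin (n+1)) → ℂ) : Prop where
  subset_of_ne_zero : ∀ s, k s ≠ 0 → b ⊆ s
  eq_insert : ∀ s ∉ S, ∀ i, insert i s \ b ∪ suppV A ∈ S → k s = k (insert i s)

namespace IsShiftCompatible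

variable {n : ℕ} {S : Set (Finset (Fin (n+1)))} {A : Fin (n+1) → ℕ}
  {b : Finset (Fin (n+1))} {k : Finset (Fin (n+1)) → ℂ}

lemma mk_shiftMap_X_mul_monomial (hS : IsSimplicialComplex S)
    (hk : IsShiftCompatible S A b k) (i : Fin (n+1)) {m : Fin (n+1) →₀ ℕ}
    (hm : m.support ∉ S) (r : ℂ) :
    Ideal.Quotient.mk (SRideal S) (shiftMap A b k (X i * monomial m r)) =
      Ideal.Quotient.mk (SRideal S) (X i * shiftMap A b k (monomial m r)) := by
  have hsupp : (Finsupp.single i 1 + m).support = insert i m.support := by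
    ext j
    by_cases h : i = j <;> simp [h, eq_comm]
  have hexp (hb : b ⊆ m.support) :
      (fun j => (Finsupp.single i 1 + m : Fin (n+1) →₀ ℕ) j - charVec b j + A j) =
        Pi.single i 1 + fun j => m j - charVec b j + A j := by
    funext j
    have := @hb j
    simp only [Finsupp.mem_support_iff] at this
    simp only [charVec, Finsupp.add_apply, Pi.add_apply, Finsupp.single_apply, Pi.single_apply]
    grind
  have key : Ideal.Quotient.mk (SRideal S) (C (k (insert i m.support)) *
        emon fun j => (Finsupp.single i 1 + m : Fin (n+1) →₀ ℕ) j - charVec b j + A j) =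
      Ideal.Quotient.mk (SRideal S) (C (k m.support) *
        emon (Pi.single i 1 + fun j => m j - charVec b j + A j)) := by
    by_cases hU : insert i m.support \ b ∪ suppV A ∈ S
    · rw [← hk.eq_insert _ hm i hU]
      by_cases h0 : k m.support = 0
      · simp [h0]
      · rw [hexp (hk.subset_of_ne_zero _ h0)]
    · have hz : ∀ μ : ℂ, Ideal.Quotient.mk (SRideal S) (C μ *
          emon fun j => (Finsupp.single i 1 + m : Fin (n+1) →₀ ℕ) j - charVec b j + A j) = 0 := fun μ => by
        rw [mk_C_mul_emon_eq_zero_iff hS]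
        refine Or.inr fun h => hU (hS.2 _ h _ fun j hj => ?_)
        rw [← hsupp] at hj
        simp only [suppV, charVec, Finset.mem_union, Finset.mem_sdiff, Finset.mem_filter,
          Finsupp.mem_support_iff, Finset.mem_univ, true_and] at hj ⊢
        grind
      rw [hz]
      by_cases h0 : k m.support = 0
      · simp [h0]
      · rw [← hexp (hk.subset_of_ne_zero _ h0), hz]
  have hX : X i * monomial m r = monomial (Finsupp.single i 1 + m) r := by
    rw [X, monomial_mul, one_mul]
  rw [hX, shiftMap_monomial, shiftMap_monomial, hsupp, map_mul, key, ← map_mul, emon_add,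
    ← X_eq_emon]
  congr 1
  ring

lemma mk_shiftMap_mul (hS : IsSimplicialComplex S) (hk : IsShiftCompatible S A b k)
    (q : MvPolynomial (Fin (n+1)) ℂ) {u : MvPolynomial (Fin (n+1)) ℂ} (hu : u ∈ SRideal S) :
    Ideal.Quotient.mk (SRideal S) (shiftMap A b k (q * u)) =
      Ideal.Quotient.mk (SRideal S) (q * shiftMap A b k u) := by
  induction q using MvPolynomial.induction_on generalizing u with
  | C a => rw [← smul_eq_C_mul, map_smul, smul_eq_C_mul]
  | add p q hp hq => simp only [add_mul, map_add, hp hu, hq hu]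
  | mul_X p i hp =>
    rw [mul_assoc, hp (Ideal.mul_mem_left _ _ hu), mul_assoc, map_mul, map_mul _ p]
    congr 1
    rw [mem_SRideal_iff hS] at hu
    rw [u.as_sum]
    simp only [Finset.mul_sum, map_sum]
    exact Finset.sum_congr rfl fun m hm => hk.mk_shiftMap_X_mul_monomial hS i (hu m hm) _

/-- The homomorphism `I_X → A_X` induced by `shiftMap`. -/
noncomputable def hom (hS : IsSimplicialComplex S) (hk : IsShiftCompatible S A b k) :
    SRideal S →ₗ[MvPolynomial (Fin (n+1)) ℂ] (MvPolynomial (Fin (n+1)) ℂ ⧸ SRideal S) where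
  toFun u := Ideal.Quotient.mk (SRideal S) (shiftMap A b k u)
  map_add' u v := by simp
  map_smul' q u := hk.mk_shiftMap_mul hS q u.2

lemma hom_xmon (hS : IsSimplicialComplex S) (hk : IsShiftCompatible S A b k)
    {p : Finset (Fin (n+1))} (hp : p ∉ S) :
    hk.hom hS ⟨xmon p, xmon_mem_SRideal S hp⟩ = Ideal.Quotient.mk (SRideal S)
      (C (k p) * emon fun i => charVec p i - charVec b i + A i) :=
  congrArg _ (shiftMap_xmon A b k p)

end IsShiftCompatible

section Degree

variable {n : ℕ} {A : Fin (n+1) → ℕ} {b p : Finset (Fin (n+1))}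

lemma charVec_add_degC_nonneg_iff (hdisj : ∀ i ∈ b, A i = 0) :
    (∀ i, 0 ≤ (charVec p i : ℤ) + degC A b i) ↔ b ⊆ p := by
  refine forall_congr' fun i => ?_
  have := hdisj i
  simp only [charVec, degC]
  grind

lemma shiftExp_degC (hb : b ⊆ p) :
    shiftExp p (degC A b) = fun i => charVec p i - charVec b i + A i := by
  funext i
  have := @hb i
  simp only [shiftExp, charVec, degC]
  grind

lemma suppV_shiftExp_degC (hb : b ⊆ p) :
    suppV (shiftExp p (degC A b)) = p \ b ∪ suppV A := by
  ext i
  have := @hb i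
  simp only [shiftExp_degC hb, suppV, charVec, Finset.mem_union, Finset.mem_sdiff,
    Finset.mem_filter, Finset.mem_univ, true_and]
  grind

lemma shiftExp_union_degC (hp : p ∩ b = ∅) :
    shiftExp (p ∪ b) (degC A b) = fun i => charVec p i + A i := by
  funext i
  have : i ∈ p → i ∉ b := fun h h' => Finset.notMem_empty i (hp ▸ Finset.mem_inter.2 ⟨h, h'⟩)
  simp only [shiftExp, charVec, degC, Finset.mem_union]
  grind

lemma charVec_sdiff_add_shiftExp (hdisj : ∀ i ∈ b, A i = 0) (hb : b ⊆ p) :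
    charVec ((p \ b ∪ suppV A ∪ b) \ p) + shiftExp p (degC A b) =
      fun i => charVec (p \ b ∪ suppV A) i + A i := by
  rw [shiftExp_degC hb]
  funext i
  have h1 := @hb i
  have h2 := hdisj i
  simp only [charVec, suppV, Pi.add_apply, Finset.mem_sdiff, Finset.mem_union,
    Finset.mem_filter, Finset.mem_univ, true_and]
  grind

end Degree

lemma suppV_charVec_add {n : ℕ} {A : Fin (n+1) → ℕ} {f : Finset (Fin (n+1))}
    (h : suppV A ⊆ f) : suppV (fun i => charVec f i + A i) = f := by
  rw [show (fun i => charVec f i + A i) = charVec f + A from rfl, suppV_add, suppV_charVec,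
    Finset.union_eq_left.2 h]

lemma IsShiftCompatible.isHomOfDeg {n : ℕ} {S : Set (Finset (Fin (n+1)))}
    (hS : IsSimplicialComplex S) {A : Fin (n+1) → ℕ} {b : Finset (Fin (n+1))}
    {k : Finset (Fin (n+1)) → ℂ} (hk : IsShiftCompatible S A b k)
    (hdisj : ∀ i ∈ b, A i = 0) : IsHomOfDeg S (hk.hom hS) (degC A b) := by
  intro p hp
  rw [charVec_add_degC_nonneg_iff hdisj, hk.hom_xmon hS hp]
  refine ⟨fun hb => ⟨k p, by rw [shiftExp_degC hb]⟩, fun hb => ?_⟩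
  rw [not_imp_comm.1 (hk.subset_of_ne_zero p) hb]
  simp

open Classical in
/-- Extension of a function on `N_{a−b}` to all supports, by way of `s ↦ (s \ b) ∪ a`. -/
noncomputable def extendNab {n : ℕ} {S : Set (Finset (Fin (n+1)))} {a b : Finset (Fin (n+1))}
    (lam : {f : Finset (Fin (n+1)) // f ∈ Nab S a b} → ℂ) (s : Finset (Fin (n+1))) : ℂ :=
  if h : b ⊆ s ∧ s \ b ∪ a ∈ Nab S a b then lam ⟨_, h.2⟩ else 0

lemma extendNab_union {n : ℕ} {S : Set (Finset (Fin (n+1)))} {a b : Finset (Fin (n+1))}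
    (lam : {f : Finset (Fin (n+1)) // f ∈ Nab S a b} → ℂ)
    (f : {f : Finset (Fin (n+1)) // f ∈ Nab S a b}) : extendNab lam (f.1 ∪ b) = lam f := by
  have hf : (f.1 ∪ b) \ b ∪ a = f.1 := by
    rw [Finset.union_sdiff_right, Finset.sdiff_eq_self_of_disjoint
      (Finset.disjoint_iff_inter_eq_empty.2 f.2.2.2.1), Finset.union_eq_left.2 f.2.2.1]
  have h : b ⊆ f.1 ∪ b ∧ (f.1 ∪ b) \ b ∪ a ∈ Nab S a b :=
    ⟨Finset.subset_union_right, hf.symm ▸ f.2⟩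
  rw [extendNab, dif_pos h]
  exact congrArg lam (Subtype.ext hf)

/-- Membership in `N_{a−b}` of the face attached to a nonface `s`. -/
lemma sdiff_union_mem_Nab {n : ℕ} {S : Set (Finset (Fin (n+1)))} (hS : IsSimplicialComplex S)
    {a b s : Finset (Fin (n+1))} (hab : Disjoint a b) (hs : s ∉ S) (h : s \ b ∪ a ∈ S) :
    s \ b ∪ a ∈ Nab S a b := by
  refine ⟨h, Finset.subset_union_right, ?_, fun h' => hs (hS.2 _ h' _ fun i hi => ?_)⟩
  · rw [← Finset.disjoint_iff_inter_eq_empty, Finset.disjoint_union_left]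
    exact ⟨Finset.sdiff_disjoint, hab⟩
  · simp only [Finset.mem_union, Finset.mem_sdiff]
    tauto

lemma isShiftCompatible_extendNab {n : ℕ} {S : Set (Finset (Fin (n+1)))}
    (hS : IsSimplicialComplex S) {A : Fin (n+1) → ℕ} {b : Finset (Fin (n+1))}
    (hab : Disjoint (suppV A) b) {lam : {f : Finset (Fin (n+1)) // f ∈ Nab S (suppV A) b} → ℂ}
    (h0 : ∀ f, f.1 ∈ Ntilde S (suppV A) b → lam f = 0)
    (h1 : ∀ f g, f.1 ∪ g.1 ∈ S → lam f = lam g) :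
    IsShiftCompatible S A b (extendNab lam) where
  subset_of_ne_zero s hs := by
    by_contra hb
    exact hs (dif_neg fun h => hb h.1)
  eq_insert s hs i hU := by
    have hs' : insert i s ∉ S := fun h => hs (hS.2 _ h _ (Finset.subset_insert i s))
    have hN' := sdiff_union_mem_Nab hS hab hs' hU
    have hle : s \ b ∪ suppV A ⊆ insert i s \ b ∪ suppV A :=
      Finset.union_subset_union_left
        (Finset.sdiff_subset_sdiff (Finset.subset_insert i s) subset_rfl)
    by_cases hb : b ⊆ s
    · have hN := sdiff_union_mem_Nab hS hab hs (hS.2 _ hU _ hle)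
      rw [extendNab, extendNab, dif_pos ⟨hb, hN⟩,
        dif_pos ⟨hb.trans (Finset.subset_insert i s), hN'⟩]
      exact h1 _ _ (by rwa [Finset.union_eq_right.2 hle])
    · rw [extendNab, dif_neg fun h => hb h.1, extendNab]
      split_ifs with h
      · refine (h0 _ ⟨hN', s ∩ b, ⟨Finset.inter_subset_right, fun h' =>
          hb (h'.trans Finset.inter_subset_left)⟩, fun h' => hs (hS.2 _ h' _ fun j hj => ?_)⟩).symm
        simp only [Finset.mem_union, Finset.mem_sdiff, Finset.mem_inter, Finset.mem_insert]
        tauto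
      · rfl

namespace IsHomOfDeg

variable {n : ℕ} {S : Set (Finset (Fin (n+1)))} {A : Fin (n+1) → ℕ} {b : Finset (Fin (n+1))}
  {φ ψ : SRideal S →ₗ[MvPolynomial (Fin (n+1)) ℂ] (MvPolynomial (Fin (n+1)) ℂ ⧸ SRideal S)}

lemma exists_scalar (hdisj : ∀ i ∈ b, A i = 0) (hφ : IsHomOfDeg S φ (degC A b))
    (f : {f : Finset (Fin (n+1)) // f ∈ Nab S (suppV A) b}) :
    ∃ μ : ℂ, φ ⟨xmon (f.1 ∪ b), xmon_mem_SRideal S f.2.2.2.2⟩ =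
      Ideal.Quotient.mk (SRideal S) (C μ * emon (fun i => charVec f.1 i + A i)) := by
  rw [← shiftExp_union_degC f.2.2.2.1]
  exact (hφ _ f.2.2.2.2).1 ((charVec_add_degC_nonneg_iff hdisj).2 Finset.subset_union_right)

/-- The function `λ_φ` on `N_{a−b}` attached to a homomorphism of degree `𝐚 − 𝐛`. -/
noncomputable def lam (hdisj : ∀ i ∈ b, A i = 0) (hφ : IsHomOfDeg S φ (degC A b))
    (f : {f : Finset (Fin (n+1)) // f ∈ Nab S (suppV A) b}) : ℂ :=
  (hφ.exists_scalar hdisj f).choose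

lemma map_xmon_union (hdisj : ∀ i ∈ b, A i = 0) (hφ : IsHomOfDeg S φ (degC A b))
    (f : {f : Finset (Fin (n+1)) // f ∈ Nab S (suppV A) b}) :
    φ ⟨xmon (f.1 ∪ b), xmon_mem_SRideal S f.2.2.2.2⟩ =
      Ideal.Quotient.mk (SRideal S)
        (C (hφ.lam hdisj f) * emon (fun i => charVec f.1 i + A i)) :=
  (hφ.exists_scalar hdisj f).choose_spec

lemma lam_eq (hS : IsSimplicialComplex S) (hdisj : ∀ i ∈ b, A i = 0)
    (hφ : IsHomOfDeg S φ (degC A b))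
    (f : {f : Finset (Fin (n+1)) // f ∈ Nab S (suppV A) b}) {μ : ℂ}
    (h : φ ⟨xmon (f.1 ∪ b), xmon_mem_SRideal S f.2.2.2.2⟩ =
      Ideal.Quotient.mk (SRideal S) (C μ * emon (fun i => charVec f.1 i + A i))) :
    hφ.lam hdisj f = μ :=
  mk_C_mul_emon_inj hS ((suppV_charVec_add f.2.2.1).symm ▸ f.2.1)
    ((hφ.map_xmon_union hdisj f).symm.trans h)

lemma lam_eq_zero (hS : IsSimplicialComplex S) (hdisj : ∀ i ∈ b, A i = 0)
    (hφ : IsHomOfDeg S φ (degC A b))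
    (f : {f : Finset (Fin (n+1)) // f ∈ Nab S (suppV A) b})
    (hf : f.1 ∈ Ntilde S (suppV A) b) : hφ.lam hdisj f = 0 := by
  obtain ⟨-, b', hb', hfb'⟩ := hf
  refine hφ.lam_eq hS hdisj f ?_
  rw [map_xmon_eq_emon_mul φ hfb' f.2.2.2.2 (Finset.union_subset_union_right hb'.1),
    (hφ _ hfb').2]
  · simp
  · rw [charVec_add_degC_nonneg_iff hdisj]
    refine fun h => hb'.2 fun i hi => (Finset.mem_union.1 (h hi)).resolve_left fun hif => ?_
    exact Finset.notMem_empty i (f.2.2.2.1 ▸ Finset.mem_inter.2 ⟨hif, hi⟩)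

lemma lam_eq_of_subset (hS : IsSimplicialComplex S) (hdisj : ∀ i ∈ b, A i = 0)
    (hφ : IsHomOfDeg S φ (degC A b))
    (f g : {f : Finset (Fin (n+1)) // f ∈ Nab S (suppV A) b}) (hfg : f.1 ⊆ g.1) :
    hφ.lam hdisj g = hφ.lam hdisj f := by
  refine hφ.lam_eq hS hdisj g ?_
  rw [map_xmon_eq_emon_mul φ f.2.2.2.2 g.2.2.2.2 (Finset.union_subset_union_left hfg),
    hφ.map_xmon_union hdisj, ← map_mul, mul_left_comm, ← emon_add]
  congr 3
  funext i
  have h1 := @hfg i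
  have h2 : i ∈ g.1 → i ∉ b := fun h h' =>
    Finset.notMem_empty i (g.2.2.2.1 ▸ Finset.mem_inter.2 ⟨h, h'⟩)
  simp only [charVec, Pi.add_apply, Finset.mem_sdiff, Finset.mem_union]
  grind

lemma lam_eq_of_union_mem (hS : IsSimplicialComplex S) (hdisj : ∀ i ∈ b, A i = 0)
    (hφ : IsHomOfDeg S φ (degC A b))
    (f g : {f : Finset (Fin (n+1)) // f ∈ Nab S (suppV A) b}) (hfg : f.1 ∪ g.1 ∈ S) :
    hφ.lam hdisj f = hφ.lam hdisj g := by
  have hN : f.1 ∪ g.1 ∈ Nab S (suppV A) b := by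
    refine ⟨hfg, f.2.2.1.trans Finset.subset_union_left, ?_, fun h => f.2.2.2.2 (hS.2 _ h _
      (Finset.union_subset_union_left Finset.subset_union_left))⟩
    rw [Finset.union_inter_distrib_right, f.2.2.2.1, g.2.2.2.1, Finset.union_empty]
  rw [← hφ.lam_eq_of_subset hS hdisj f ⟨_, hN⟩ Finset.subset_union_left,
    ← hφ.lam_eq_of_subset hS hdisj g ⟨_, hN⟩ Finset.subset_union_right]

lemma map_xmon_eq_zero (hS : IsSimplicialComplex S) (hφ : IsHomOfDeg S φ (degC A b))
    (hdisj : ∀ i ∈ b, A i = 0) {p : Finset (Fin (n+1))} (hp : p ∉ S)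
    (h : b ⊆ p → p \ b ∪ suppV A ∉ S) : φ ⟨xmon p, xmon_mem_SRideal S hp⟩ = 0 := by
  by_cases hb : b ⊆ p
  · obtain ⟨μ, hμ⟩ := (hφ p hp).1 ((charVec_add_degC_nonneg_iff hdisj).2 hb)
    rw [hμ, mk_C_mul_emon_eq_zero_iff hS, suppV_shiftExp_degC hb]
    exact Or.inr (h hb)
  · exact (hφ p hp).2 (mt (charVec_add_degC_nonneg_iff hdisj).1 hb)

/-- The scalar of `φ` at a nonface `p ⊇ b` is the value of `λ_φ` at `(p \ b) ∪ a`. -/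
lemma map_xmon_eq (hS : IsSimplicialComplex S) (hdisj : ∀ i ∈ b, A i = 0)
    (hφ : IsHomOfDeg S φ (degC A b)) {p : Finset (Fin (n+1))} (hp : p ∉ S) (hb : b ⊆ p)
    (hN : p \ b ∪ suppV A ∈ Nab S (suppV A) b) :
    φ ⟨xmon p, xmon_mem_SRideal S hp⟩ = Ideal.Quotient.mk (SRideal S)
      (C (hφ.lam hdisj ⟨_, hN⟩) * emon (shiftExp p (degC A b))) := by
  obtain ⟨μ, hμ⟩ := (hφ p hp).1 ((charVec_add_degC_nonneg_iff hdisj).2 hb)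
  have hsub : p ⊆ (p \ b ∪ suppV A) ∪ b := fun i hi => by
    simp only [Finset.mem_union, Finset.mem_sdiff]
    tauto
  have h := map_xmon_eq_emon_mul φ hp hN.2.2.2 hsub
  rw [hμ, ← map_mul, mul_left_comm, ← emon_add, charVec_sdiff_add_shiftExp hdisj hb] at h
  rw [hμ, hφ.lam_eq hS hdisj ⟨_, hN⟩ h]

lemma eq_of_lam_eq (hS : IsSimplicialComplex S) (hdisj : ∀ i ∈ b, A i = 0)
    (hφ : IsHomOfDeg S φ (degC A b)) (hψ : IsHomOfDeg S ψ (degC A b))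
    (h : hφ.lam hdisj = hψ.lam hdisj) : φ = ψ := by
  refine linearMap_SRideal_ext fun p hp => ?_
  by_cases hU : b ⊆ p ∧ p \ b ∪ suppV A ∈ S
  · have hab : Disjoint (suppV A) b := Finset.disjoint_right.2 fun i hi => by
      simp [suppV, hdisj i hi]
    have hN := sdiff_union_mem_Nab hS hab hp hU.2
    rw [hφ.map_xmon_eq hS hdisj hp hU.1 hN, hψ.map_xmon_eq hS hdisj hp hU.1 hN, h]
  · rw [hφ.map_xmon_eq_zero hS hdisj hp (not_and.1 hU),
      hψ.map_xmon_eq_zero hS hdisj hp (not_and.1 hU)]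

lemma lam_add {ω : SRideal S →ₗ[MvPolynomial (Fin (n+1)) ℂ]
      (MvPolynomial (Fin (n+1)) ℂ ⧸ SRideal S)}
    (hS : IsSimplicialComplex S) (hdisj : ∀ i ∈ b, A i = 0)
    (hφ : IsHomOfDeg S φ (degC A b)) (hψ : IsHomOfDeg S ψ (degC A b))
    (hω : IsHomOfDeg S ω (degC A b)) (h : ω = φ + ψ)
    (f : {f : Finset (Fin (n+1)) // f ∈ Nab S (suppV A) b}) :
    hω.lam hdisj f = hφ.lam hdisj f + hψ.lam hdisj f := by
  refine hω.lam_eq hS hdisj f ((LinearMap.congr_fun h _).trans ?_)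
  rw [C_add, add_mul, map_add, ← hφ.map_xmon_union hdisj f, ← hψ.map_xmon_union hdisj f]
  rfl

lemma lam_C_smul (hS : IsSimplicialComplex S) (hdisj : ∀ i ∈ b, A i = 0)
    (hφ : IsHomOfDeg S φ (degC A b)) (hψ : IsHomOfDeg S ψ (degC A b)) {μ : ℂ}
    (h : ψ = (C μ : MvPolynomial (Fin (n+1)) ℂ) • φ)
    (f : {f : Finset (Fin (n+1)) // f ∈ Nab S (suppV A) b}) :
    hψ.lam hdisj f = μ * hφ.lam hdisj f := by
  refine hψ.lam_eq hS hdisj f ((LinearMap.congr_fun h _).trans ?_)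
  rw [C_mul, mul_assoc, map_mul, ← hφ.map_xmon_union hdisj f]
  rfl

end IsHomOfDeg

/-- for `𝐜 = 𝐚 − 𝐛`:  every `f ∈ N_{a−b}` satisfies `f ∪ b ∉ X` (so
`x^{f∪b} ∈ I_X`) and `π(x^{𝐟+𝐚}) ≠ 0`; and `φ ↦ λ_φ` is a ℂ-linear isomorphism from
`Hom(I_X,A_X)_𝐜` onto `{λ : N_{a−b} → ℂ : λ = 0 on Ñ_{a−b}, λ(f) = λ(g) if f ∪ g ∈ X}`. -/
theorem hom_piece_iso_N_functions {n : ℕ} (S : Set (Finset (Fin (n+1))))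
    (hS : IsSimplicialComplex S) (A : Fin (n+1) → ℕ) (b : Finset (Fin (n+1)))
    (hdisj : ∀ i ∈ b, A i = 0) :
    (∀ f ∈ Nab S (suppV A) b, f ∪ b ∉ S ∧
      Ideal.Quotient.mk (SRideal S) (emon (fun i => charVec f i + A i)) ≠ 0) ∧
    ∃ E : {φ : SRideal S →ₗ[MvPolynomial (Fin (n+1)) ℂ]
            (MvPolynomial (Fin (n+1)) ℂ ⧸ SRideal S) // IsHomOfDeg S φ (degC A b)} ≃
          {lam : {f : Finset (Fin (n+1)) // f ∈ Nab S (suppV A) b} → ℂ //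
            (∀ f, f.1 ∈ Ntilde S (suppV A) b → lam f = 0) ∧
            ∀ f g, f.1 ∪ g.1 ∈ S → lam f = lam g},
      (∀ (φ : {φ : SRideal S →ₗ[MvPolynomial (Fin (n+1)) ℂ]
            (MvPolynomial (Fin (n+1)) ℂ ⧸ SRideal S) // IsHomOfDeg S φ (degC A b)})
         (f : {f : Finset (Fin (n+1)) // f ∈ Nab S (suppV A) b}),
        φ.1 ⟨xmon (f.1 ∪ b), xmon_mem_SRideal S f.2.2.2.2⟩ =
          Ideal.Quotient.mk (SRideal S)
            (C ((E φ).1 f) * emon (fun i => charVec f.1 i + A i))) ∧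
      (∀ φ ψ ω, ω.1 = φ.1 + ψ.1 → ∀ f, (E ω).1 f = (E φ).1 f + (E ψ).1 f) ∧
      (∀ (μ₀ : ℂ) φ ψ, ψ.1 = (C μ₀ : MvPolynomial (Fin (n+1)) ℂ) • φ.1 →
        ∀ f, (E ψ).1 f = μ₀ * (E φ).1 f) := by
  have hab : Disjoint (suppV A) b := Finset.disjoint_right.2 fun i hi => by
    simp [suppV, hdisj i hi]
  refine ⟨fun f hf => ⟨hf.2.2.2, fun h => ?_⟩,
    Equiv.ofBijective (fun φ => ⟨φ.2.lam hdisj, φ.2.lam_eq_zero hS hdisj,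
      φ.2.lam_eq_of_union_mem hS hdisj⟩) ⟨fun φ ψ h => ?_, fun lam => ?_⟩,
    fun φ f => φ.2.map_xmon_union hdisj f, fun φ ψ ω h => φ.2.lam_add hS hdisj ψ.2 ω.2 h,
    fun μ₀ φ ψ h => φ.2.lam_C_smul hS hdisj ψ.2 h⟩
  · have := (mk_C_mul_emon_eq_zero_iff hS 1 _).1 (by rwa [C_1, one_mul])
    rw [suppV_charVec_add hf.2.1] at this
    exact this.elim one_ne_zero fun h => h hf.1
  · exact Subtype.ext (φ.2.eq_of_lam_eq hS hdisj ψ.2 (congrArg Subtype.val h))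
  · have hk := isShiftCompatible_extendNab hS hab lam.2.1 lam.2.2
    refine ⟨⟨hk.hom hS, hk.isHomOfDeg hS hdisj⟩, Subtype.ext (funext fun f => ?_)⟩
    refine (hk.isHomOfDeg hS hdisj).lam_eq hS hdisj f ?_
    rw [hk.hom_xmon hS f.2.2.2.2, ← shiftExp_degC Finset.subset_union_right,
      shiftExp_union_degC f.2.2.2.1, extendNab_union]
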